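/- Let H be a connected finite directed multigraph with every source and sink of degree one, no idle edges, and a cyclic ample framing. Then every balanced nonnegative flow f on H can be written uniquely as a nonnegative combination of indicator flows of pairwise compatible routes: there is exactly one function a from the (finite) set of routes of H (minimal cycles and good routes) to ℝ_{≥0} such that the support of a is a clique and f = Σ_ρ a(ρ)·1_ρ. Moreover, if f is integer-valued, then a is integer-valued. -/

import Mathlib

namespace PaperDKK

/-- Edge colours for framings. -/
inductive Col : Type
  | red : Col
  | blue : Col
  deriving DecidableEq

variable {V E : Type*}

/-- The list of vertices visited by a walk. -/
def walkVerts (tl hd : E → V) : List E → List V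
  | [] => []
  | e :: es => tl e :: (e :: es).map hd

/-- A walk: a nonempty list of consecutively composable edges. -/
def IsWalk (tl hd : E → V) (w : List E) : Prop :=
  w ≠ [] ∧ List.Chain' (fun e f => hd e = tl f) w

/-- A source: a vertex that is the head of no edge. -/
def IsSource (tl hd : E → V) (v : V) : Prop := ∀ e : E, hd e ≠ v

/-- A sink: a vertex that is the tail of no edge. -/
def IsSink (tl hd : E → V) (v : V) : Prop := ∀ e : E, tl e ≠ v

/-- An internal vertex: neither a source nor a sink. -/
def IsInternal (tl hd : E → V) (v : V) : Prop :=
  ¬ IsSource tl hd v ∧ ¬ IsSink tl hd v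

/-- A minimal directed cycle: a closed walk visiting no vertex twice. -/
def IsMinCycle (tl hd : E → V) (w : List E) : Prop :=
  IsWalk tl hd w ∧
  (∀ e ∈ w.getLast?, ∀ f ∈ w.head?, hd e = tl f) ∧
  (w.map hd).Nodup

/-- A walk from a source to a sink. -/
def IsSrcSnkWalk (tl hd : E → V) (w : List E) : Prop :=
  IsWalk tl hd w ∧
  (∀ e ∈ w.head?, IsSource tl hd (tl e)) ∧
  (∀ e ∈ w.getLast?, IsSink tl hd (hd e))

/-- A route: a minimal directed cycle or a source-to-sink walk. -/
def IsRoute (tl hd : E → V) (w : List E) : Prop :=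
  IsMinCycle tl hd w ∨ IsSrcSnkWalk tl hd w

/-- A good route: a source-to-sink walk none of whose contiguous subwalks is a
minimal directed cycle. -/
def IsGoodRoute (tl hd : E → V) (w : List E) : Prop :=
  IsSrcSnkWalk tl hd w ∧ ∀ u : List E, u <:+: w → ¬ IsMinCycle tl hd u

/-- A monochromatic list of edges. -/
def Mono (col : E → Col) (w : List E) : Prop :=
  ∃ b : Col, ∀ e ∈ w, col e = b

/-- Cyclic ample framing: at every internal vertex there is exactly one red and
one blue incoming edge and exactly one red and one blue outgoing edge, and every
minimal directed cycle is monochromatic. -/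
def CyclicAmpleFraming (tl hd : E → V) (col : E → Col) : Prop :=
  (∀ v : V, IsInternal tl hd v →
    (∃! e : E, hd e = v ∧ col e = Col.red) ∧
    (∃! e : E, hd e = v ∧ col e = Col.blue) ∧
    (∃! e : E, tl e = v ∧ col e = Col.red) ∧
    (∃! e : E, tl e = v ∧ col e = Col.blue)) ∧
  (∀ w : List E, IsMinCycle tl hd w → Mono col w)

/-- Incompatibility of two source-to-sink walks: they admit decompositions
`P·S·Q` and `P′·S·Q′` along a common (possibly vertex-only) subwalk `S`, with
the last edge of `P` and the first edge of `Q′` blue while the first edge of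
`Q` and the last edge of `P′` are red.  Here the `P`-part is `P ++ [p]` and the
`Q`-part is `q :: Q`, so `p` is the last edge of the `P`-part and `q` the first
edge of the `Q`-part. -/
def Incompat (tl hd : E → V) (col : E → Col) (w w' : List E) : Prop :=
  IsSrcSnkWalk tl hd w ∧ IsSrcSnkWalk tl hd w' ∧
  ∃ (P S Q P' Q' : List E) (p q p' q' : E),
    ((w = P ++ p :: (S ++ q :: Q) ∧ w' = P' ++ p' :: (S ++ q' :: Q')) ∨
     (w' = P ++ p :: (S ++ q :: Q) ∧ w = P' ++ p' :: (S ++ q' :: Q'))) ∧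
    hd p = hd p' ∧
    col p = Col.blue ∧ col q' = Col.blue ∧ col q = Col.red ∧ col p' = Col.red

/-- A route is exceptional if it is compatible with every route. -/
def Exceptional (tl hd : E → V) (col : E → Col) (w : List E) : Prop :=
  IsRoute tl hd w ∧ ∀ w' : List E, IsRoute tl hd w' → ¬ Incompat tl hd col w w'

/-- Connectivity of the underlying undirected graph. -/
def Connected (tl hd : E → V) : Prop :=
  ∀ v w : V,
    Relation.ReflTransGen
      (fun x y => ∃ e : E, (tl e = x ∧ hd e = y) ∨ (tl e = y ∧ hd e = x)) v w

/-- Every source and every sink has degree one. -/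
def DegreeOneEnds (tl hd : E → V) : Prop :=
  (∀ v : V, IsSource tl hd v → ∃! e : E, tl e = v) ∧
  (∀ v : V, IsSink tl hd v → ∃! e : E, hd e = v)

/-- No idle edges: no edge between internal vertices is the unique outgoing edge
of its tail or the unique incoming edge of its head. -/
def NoIdleEdges (tl hd : E → V) : Prop :=
  ∀ e : E, IsInternal tl hd (tl e) → IsInternal tl hd (hd e) →
    (∃ f : E, f ≠ e ∧ tl f = tl e) ∧ (∃ f : E, f ≠ e ∧ hd f = hd e)

/-- The edge set of a minimal directed cycle (minimal cycles are identified up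
to cyclic rotation, hence with their edge sets). -/
def IsCycleSet (tl hd : E → V) [DecidableEq E] (C : Finset E) : Prop :=
  ∃ w : List E, IsMinCycle tl hd w ∧ w.toFinset = C

/-- The routes of the graph: minimal directed cycles (up to rotation, i.e. as
edge sets) together with good routes. -/
abbrev RoutesT (tl hd : E → V) [DecidableEq E] : Type _ :=
  {C : Finset E // IsCycleSet tl hd C} ⊕ {w : List E // IsGoodRoute tl hd w}

/-- The indicator flow of a route: how many times the route traverses each edge. -/
def rInd (tl hd : E → V) [DecidableEq E] : RoutesT tl hd → E → ℝ
  | Sum.inl C => fun e => if e ∈ C.1 then 1 else 0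
  | Sum.inr w => fun e => (w.1.count e : ℝ)

/-- Compatibility of routes: minimal cycles are compatible with everything;
two good routes are compatible when they are not incompatible. -/
def RCompat (tl hd : E → V) [DecidableEq E] (col : E → Col) :
    RoutesT tl hd → RoutesT tl hd → Prop
  | Sum.inr w, Sum.inr w' => ¬ Incompat tl hd col w.1 w'.1
  | _, _ => True

/-- A clique: a set of routes that are pairwise compatible and each compatible
with itself. -/
def RClique (tl hd : E → V) [DecidableEq E] (col : E → Col)
    (K : Set (RoutesT tl hd)) : Prop :=
  ∀ r ∈ K, ∀ r' ∈ K, RCompat tl hd col r r'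

/-- Netflow of a real flow at a vertex. -/
def netflowR (tl hd : E → V) [Fintype E] [DecidableEq V] (f : E → ℝ) (v : V) : ℝ :=
  (∑ e ∈ Finset.univ.filter (fun e => tl e = v), f e) -
  (∑ e ∈ Finset.univ.filter (fun e => hd e = v), f e)

section Walks

/-- Consecutive edges of the list are composable. -/
abbrev Composable (tl hd : E → V) (w : List E) : Prop :=
  List.IsChain (fun e f => hd e = tl f) w

variable {tl hd : E → V} {col : E → Col}

theorem nodup_map_hd_of_forall_not_isMinCycle {w : List E} (hw : Composable tl hd w)
    (h : ∀ u, u <:+: w → ¬ IsMinCycle tl hd u) : (w.map hd).Nodup := by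
  induction w using List.reverseRecOn with
  | nil => simp
  | append_singleton w y ih =>
    have hw' : Composable tl hd w := hw.infix (List.prefix_append _ _).isInfix
    have ih := ih hw' fun u hu => h u (hu.trans (List.prefix_append _ _).isInfix)
    rw [List.map_append, List.map_singleton, ← List.concat_eq_append, List.nodup_concat]
    refine ⟨fun hy => ?_, ih⟩
    obtain ⟨x, hx, hxy⟩ := List.mem_map.1 hy
    obtain ⟨P, S, rfl⟩ := List.append_of_mem hx
    have hinf : S ++ [y] <:+: P ++ x :: S ++ [y] := ⟨P ++ [x], [], by simp⟩
    refine h _ hinf ⟨⟨by simp, hw.infix hinf⟩, ?_, ?_⟩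
    · have hc : Composable tl hd (x :: (S ++ [y])) := hw.infix ⟨P, [], by simp⟩
      intro e he f hf
      have : e = y := by simpa using he.symm
      subst this
      cases S with
      | nil =>
        have : f = e := by simpa using hf.symm
        subst this
        rw [← hxy]; exact (List.isChain_cons_cons.1 hc).1
      | cons s S =>
        have : f = s := by simpa using hf.symm
        subst this
        rw [← hxy]; exact (List.isChain_cons_cons.1 hc).1
    · rw [List.map_append, List.map_singleton, ← List.concat_eq_append, List.nodup_concat]
      simp only [List.map_append, List.map_cons] at ih
      have := (List.nodup_append.1 ih).2.1
      rw [List.nodup_cons] at this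
      rw [hxy] at this
      exact this

theorem Composable.map_tl {e : E} {w : List E} (h : Composable tl hd (e :: w)) :
    (e :: w).map tl = tl e :: (e :: w).dropLast.map hd := by
  induction w generalizing e with
  | nil => simp
  | cons x w ih =>
    obtain ⟨h1, h2⟩ := List.isChain_cons_cons.1 h
    rw [List.map_cons, ih h2]
    simp [h1]

theorem composable_concat {T : List E} {e : E} (hT : T ≠ []) (h : Composable tl hd T)
    (he : hd (T.getLast hT) = tl e) : Composable tl hd (T ++ [e]) := by
  rw [Composable, List.isChain_append]
  refine ⟨h, by simp, ?_⟩
  intro x hx y hy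
  rw [List.getLast?_eq_getLast_of_ne_nil hT] at hx
  simp at hx hy
  subst hx hy
  exact he

theorem Composable.hd_getLast {T : List E} {e : E} (h : Composable tl hd (T ++ [e]))
    (hT : T ≠ []) : hd (T.getLast hT) = tl e := by
  rw [Composable, List.isChain_append] at h
  exact h.2.2 _ (by rw [List.getLast?_eq_getLast_of_ne_nil hT]; simp) _ (by simp)

theorem Composable.cons_congr {p p' : E} {S : List E} (h : Composable tl hd (p :: S))
    (hp : hd p = hd p') : Composable tl hd (p' :: S) := by
  cases S with
  | nil => simp
  | cons s S =>
    rw [Composable, List.isChain_cons_cons] at h ⊢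
    exact ⟨hp ▸ h.1, h.2⟩

theorem isInternal_of_hd_eq_tl {x y : E} (h : hd x = tl y) : IsInternal tl hd (hd x) :=
  ⟨fun hs => hs x rfl, fun hs => hs y h.symm⟩

theorem Composable.tl_eq_tl {p p' q q' : E} {S : List E}
    (h : Composable tl hd (p :: (S ++ [q]))) (h' : Composable tl hd (p' :: (S ++ [q'])))
    (hp : hd p = hd p') : tl q = tl q' := by
  have h1 : Composable tl hd ((p :: S) ++ [q']) := h'.cons_congr hp.symm
  have h2 : Composable tl hd ((p :: S) ++ [q]) := h
  exact (h2.hd_getLast (by simp)).symm.trans (h1.hd_getLast (by simp))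

theorem Composable.isInternal_hd {p q : E} {S : List E}
    (h : Composable tl hd (p :: (S ++ [q]))) : IsInternal tl hd (hd p) := by
  cases S with
  | nil => exact isInternal_of_hd_eq_tl (List.isChain_cons_cons.1 h).1
  | cons s S => exact isInternal_of_hd_eq_tl (List.isChain_cons_cons.1 h).1

theorem Composable.isInternal_tl {p q : E} {S : List E}
    (h : Composable tl hd (p :: (S ++ [q]))) : IsInternal tl hd (tl q) := by
  have h2 : Composable tl hd ((p :: S) ++ [q]) := h
  rw [← h2.hd_getLast (by simp)]
  exact isInternal_of_hd_eq_tl (h2.hd_getLast (by simp))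

variable {ρ σ T : List E} {e : E}

theorem IsSrcSnkWalk.composable (h : IsSrcSnkWalk tl hd ρ) : Composable tl hd ρ := h.1.2

theorem IsSrcSnkWalk.exists_concat_infix (h : IsSrcSnkWalk tl hd ρ) (hT : T ≠ [])
    (hTρ : T <:+: ρ) (hs : ¬ IsSink tl hd (hd (T.getLast hT))) : ∃ e, T ++ [e] <:+: ρ := by
  obtain ⟨P, Q, rfl⟩ := hTρ
  cases Q with
  | nil =>
    refine absurd (h.2.2 _ ?_) hs
    rw [List.append_nil, List.getLast?_append_of_ne_nil _ hT,
      List.getLast?_eq_getLast_of_ne_nil hT]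
    simp
  | cons q Q => exact ⟨q, P, Q, by simp⟩

theorem IsSrcSnkWalk.exists_cons_infix (h : IsSrcSnkWalk tl hd ρ)
    (hTρ : e :: T <:+: ρ) (hs : ¬ IsSource tl hd (tl e)) : ∃ x, x :: e :: T <:+: ρ := by
  obtain ⟨P, Q, rfl⟩ := hTρ
  induction P using List.reverseRecOn with
  | nil => exact absurd (h.2.1 _ (by simp)) hs
  | append_singleton P p _ => exact ⟨p, P, Q, by simp⟩

theorem IsSrcSnkWalk.eq_of_infix (h : IsSrcSnkWalk tl hd ρ) (hσ : IsSrcSnkWalk tl hd σ)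
    (hi : σ <:+: ρ) : ρ = σ := by
  have hc := h.composable
  obtain ⟨P, Q, rfl⟩ := hi
  have hne := hσ.1.1
  have hQ : Q = [] := by
    cases Q with
    | nil => rfl
    | cons q Q =>
      have h1 : Composable tl hd (σ ++ [q]) := hc.infix ⟨P, Q, by simp⟩
      have h2 := h1.hd_getLast hne
      exact absurd h2.symm (hσ.2.2 _ (by rw [List.getLast?_eq_getLast_of_ne_nil hne]; simp) q)
  have hP : P = [] := by
    induction P using List.reverseRecOn with
    | nil => rfl
    | append_singleton P p _ =>
      obtain ⟨s, σ, rfl⟩ := List.exists_cons_of_ne_nil hne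
      have h1 : Composable tl hd (p :: s :: σ) := hc.infix ⟨P, Q, by simp⟩
      exact absurd (List.isChain_cons_cons.1 h1).1 (hσ.2.1 s (by simp) p)
  simp [hQ, hP]

theorem IsGoodRoute.composable (h : IsGoodRoute tl hd ρ) : Composable tl hd ρ := h.1.1.2

theorem IsGoodRoute.nodup_map_hd (h : IsGoodRoute tl hd ρ) : (ρ.map hd).Nodup :=
  nodup_map_hd_of_forall_not_isMinCycle h.composable h.2

theorem IsGoodRoute.nodup (h : IsGoodRoute tl hd ρ) : ρ.Nodup := h.nodup_map_hd.of_map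

theorem IsGoodRoute.nodup_map_tl (h : IsGoodRoute tl hd ρ) : (ρ.map tl).Nodup := by
  obtain ⟨e, w, rfl⟩ := List.exists_cons_of_ne_nil h.1.1.1
  rw [h.composable.map_tl, List.nodup_cons]
  refine ⟨fun hm => ?_, ?_⟩
  · obtain ⟨x, -, hx⟩ := List.mem_map.1 hm
    exact h.1.2.1 e (by simp) x hx
  · exact h.nodup_map_hd.sublist ((List.dropLast_sublist _).map hd)

theorem IsGoodRoute.eq_of_hd_eq (h : IsGoodRoute tl hd ρ) {x y : E} (hx : x ∈ ρ) (hy : y ∈ ρ)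
    (hxy : hd x = hd y) : x = y :=
  List.inj_on_of_nodup_map h.nodup_map_hd hx hy hxy

theorem IsGoodRoute.eq_of_tl_eq (h : IsGoodRoute tl hd ρ) {x y : E} (hx : x ∈ ρ) (hy : y ∈ ρ)
    (hxy : tl x = tl y) : x = y :=
  List.inj_on_of_nodup_map h.nodup_map_tl hx hy hxy

theorem IsGoodRoute.concat_infix (h : IsGoodRoute tl hd ρ) (hT : T ≠ []) (hTρ : T <:+: ρ)
    (he : e ∈ ρ) (hc : Composable tl hd (T ++ [e])) : T ++ [e] <:+: ρ := by
  have hl := hc.hd_getLast hT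
  obtain ⟨x, hx⟩ := h.1.exists_concat_infix hT hTρ (by rw [hl]; exact fun hs => hs e rfl)
  have hl' := Composable.hd_getLast (h.composable.infix hx) hT
  have : x = e := h.eq_of_tl_eq (hx.subset (by simp)) he (hl'.symm.trans hl)
  exact this ▸ hx

theorem IsGoodRoute.eq_of_infix (h : IsGoodRoute tl hd ρ) (hσ : IsGoodRoute tl hd σ)
    (hi : σ <:+: ρ) : ρ = σ := h.1.eq_of_infix hσ.1 hi

theorem CyclicAmpleFraming.exists_out (hfr : CyclicAmpleFraming tl hd col) {v : V}
    (hv : IsInternal tl hd v) : ∃ b r : E, tl b = v ∧ col b = .blue ∧ tl r = v ∧ col r = .red ∧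
      b ≠ r ∧ ∀ e, tl e = v ↔ e = b ∨ e = r := by
  obtain ⟨-, -, ⟨r, hr, hr'⟩, ⟨b, hb, hb'⟩⟩ := hfr.1 v hv
  refine ⟨b, r, hb.1, hb.2, hr.1, hr.2, fun h => by simp [h, hr.2] at hb, fun e => ⟨fun he => ?_, ?_⟩⟩
  · cases hc : col e with
    | red => exact Or.inr (hr' e ⟨he, hc⟩)
    | blue => exact Or.inl (hb' e ⟨he, hc⟩)
  · rintro (rfl | rfl)
    exacts [hb.1, hr.1]

theorem CyclicAmpleFraming.exists_in (hfr : CyclicAmpleFraming tl hd col) {v : V}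
    (hv : IsInternal tl hd v) : ∃ b r : E, hd b = v ∧ col b = .blue ∧ hd r = v ∧ col r = .red ∧
      b ≠ r ∧ ∀ e, hd e = v ↔ e = b ∨ e = r := by
  obtain ⟨⟨r, hr, hr'⟩, ⟨b, hb, hb'⟩, -, -⟩ := hfr.1 v hv
  refine ⟨b, r, hb.1, hb.2, hr.1, hr.2, fun h => by simp [h, hr.2] at hb, fun e => ⟨fun he => ?_, ?_⟩⟩
  · cases hc : col e with
    | red => exact Or.inr (hr' e ⟨he, hc⟩)
    | blue => exact Or.inl (hb' e ⟨he, hc⟩)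
  · rintro (rfl | rfl)
    exacts [hb.1, hr.1]

theorem CyclicAmpleFraming.eq_of_tl_eq (hfr : CyclicAmpleFraming tl hd col) {v : V}
    (hv : IsInternal tl hd v) {x y : E} (hx : tl x = v) (hy : tl y = v) (h : col x = col y) :
    x = y := by
  obtain ⟨b, r, -, hb, -, hr, -, hall⟩ := hfr.exists_out hv
  rcases (hall x).1 hx with rfl | rfl <;> rcases (hall y).1 hy with rfl | rfl <;> simp_all

theorem CyclicAmpleFraming.eq_of_hd_eq (hfr : CyclicAmpleFraming tl hd col) {v : V}
    (hv : IsInternal tl hd v) {x y : E} (hx : hd x = v) (hy : hd y = v) (h : col x = col y) :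
    x = y := by
  obtain ⟨b, r, -, hb, -, hr, -, hall⟩ := hfr.exists_in hv
  rcases (hall x).1 hx with rfl | rfl <;> rcases (hall y).1 hy with rfl | rfl <;> simp_all

end Walks

section Transport

variable [Fintype E] [DecidableEq V] (tl hd : E → V) (col : E → Col) (f : E → ℝ)

/-- The offset of the strip of `e` in the total flow arriving at the head of `e`, where blue
strips are placed below red ones. -/
noncomputable def inShift (e : E) : ℝ :=
  if col e = .red then ∑ x with hd x = hd e ∧ col x = .blue, f x else 0

/-- The offset of the strip of `e` in the total flow leaving the tail of `e`, where blue
strips are placed below red ones. -/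
noncomputable def outShift (e : E) : ℝ :=
  if col e = .red then ∑ x with tl x = tl e ∧ col x = .blue, f x else 0

/-- Move a height at the tail of `e` through the strip of `e` to a height at its head, clipping
to the strip. -/
noncomputable def strip (y : ℝ) (e : E) : ℝ :=
  max 0 (min (f e) (y - outShift tl col f e)) + inShift hd col f e

/-- Move a height through all the strips of a walk. -/
noncomputable def transport (w : List E) (y : ℝ) : ℝ :=
  w.foldl (strip tl hd col f) y

/-- The width of the band of flow which follows the walk `w`. -/
noncomputable def width (w : List E) : ℝ :=
  transport tl hd col f w (∑ e, f e) - transport tl hd col f w 0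

variable {tl hd col f}

theorem strip_mono (e : E) : Monotone fun y => strip tl hd col f y e := fun a b h => by
  have : a - outShift tl col f e ≤ b - outShift tl col f e := by linarith
  exact add_le_add_left (max_le_max le_rfl (min_le_min le_rfl this)) _

theorem transport_append (u w : List E) (y : ℝ) :
    transport tl hd col f (u ++ w) y = transport tl hd col f w (transport tl hd col f u y) :=
  List.foldl_append

theorem transport_concat (u : List E) (e : E) (y : ℝ) :
    transport tl hd col f (u ++ [e]) y = strip tl hd col f (transport tl hd col f u y) e := by
  rw [transport_append]; rfl

theorem transport_cons (e : E) (w : List E) (y : ℝ) :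
    transport tl hd col f (e :: w) y = transport tl hd col f w (strip tl hd col f y e) := rfl

theorem transport_mono (w : List E) : Monotone (transport tl hd col f w) := by
  induction w using List.reverseRecOn with
  | nil => exact monotone_id
  | append_singleton w e ih =>
    intro a b h
    rw [transport_concat, transport_concat]
    exact strip_mono e (ih h)

theorem strip_sub_le (e : E) {a b : ℝ} (h : a ≤ b) :
    strip tl hd col f b e - strip tl hd col f a e ≤ b - a := by
  unfold strip
  rcases max_cases 0 (min (f e) (b - outShift tl col f e)) with h1 | h1 <;>
  rcases max_cases 0 (min (f e) (a - outShift tl col f e)) with h2 | h2 <;>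
  rcases min_cases (f e) (b - outShift tl col f e) with h3 | h3 <;>
  rcases min_cases (f e) (a - outShift tl col f e) with h4 | h4 <;> linarith

theorem transport_sub_le (w : List E) {a b : ℝ} (h : a ≤ b) :
    transport tl hd col f w b - transport tl hd col f w a ≤ b - a := by
  induction w using List.reverseRecOn with
  | nil => exact le_rfl
  | append_singleton w e ih =>
    rw [transport_concat, transport_concat]
    exact (strip_sub_le e (transport_mono w h)).trans ih

theorem inShift_le_strip (e : E) (y : ℝ) : inShift hd col f e ≤ strip tl hd col f y e := by
  rw [strip]
  linarith [le_max_left 0 (min (f e) (y - outShift tl col f e))]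

theorem width_eq_zero_of_mem {w : List E} {e : E} (he : e ∈ w) (h0 : f e = 0) :
    width tl hd col f w = 0 := by
  obtain ⟨P, Q, rfl⟩ := List.append_of_mem he
  have h (y : ℝ) : strip tl hd col f y e = inShift hd col f e := by
    rw [strip, h0, max_eq_left (min_le_left _ _), zero_add]
  simp only [width, transport_append, transport_cons, h, sub_self]

variable (hf : ∀ e, 0 ≤ f e)
include hf

theorem outShift_nonneg (e : E) : 0 ≤ outShift tl col f e := by
  unfold outShift
  split_ifs
  exacts [Finset.sum_nonneg fun x _ => hf x, le_rfl]

theorem outShift_add_le (e : E) : outShift tl col f e + f e ≤ ∑ e, f e := by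
  classical
  unfold outShift
  split_ifs with h
  · rw [add_comm, ← Finset.sum_insert (by simp [h])]
    exact Finset.sum_le_sum_of_subset_of_nonneg (Finset.subset_univ _) fun x _ _ => hf x
  · rw [zero_add]
    exact Finset.single_le_sum (fun x _ => hf x) (Finset.mem_univ e)

theorem strip_zero (e : E) : strip tl hd col f 0 e = inShift hd col f e := by
  have := outShift_nonneg (tl := tl) (col := col) hf e
  rw [strip, max_eq_left, zero_add]
  exact (min_le_right _ _).trans (by linarith)

theorem strip_of_le (e : E) {y : ℝ} (hy : outShift tl col f e + f e ≤ y) :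
    strip tl hd col f y e = f e + inShift hd col f e := by
  rw [strip, min_eq_left (by linarith), max_eq_right (hf e)]

theorem strip_total (e : E) :
    strip tl hd col f (∑ e, f e) e = f e + inShift hd col f e :=
  strip_of_le hf e (outShift_add_le hf e)

theorem strip_le (e : E) (y : ℝ) : strip tl hd col f y e ≤ inShift hd col f e + f e := by
  rw [strip]
  linarith [max_le (hf e) (min_le_left (f e) (y - outShift tl col f e))]

theorem width_nonneg (w : List E) : 0 ≤ width tl hd col f w :=
  sub_nonneg.2 (transport_mono w (Finset.sum_nonneg fun x _ => hf x))

theorem width_singleton (e : E) : width tl hd col f [e] = f e := by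
  change strip tl hd col f (∑ e, f e) e - strip tl hd col f 0 e = f e
  rw [strip_total hf, strip_zero hf]
  ring

theorem width_append_le_left (u w : List E) :
    width tl hd col f (u ++ w) ≤ width tl hd col f u := by
  rw [width, transport_append, transport_append]
  exact transport_sub_le w (transport_mono u (Finset.sum_nonneg fun x _ => hf x))

theorem width_append_le_right (u : List E) (e : E) (w : List E) :
    width tl hd col f (u ++ e :: w) ≤ width tl hd col f (e :: w) := by
  rw [width, width, transport_append, transport_append]
  have h1 : transport tl hd col f (e :: w) (transport tl hd col f u (∑ e, f e)) ≤
      transport tl hd col f (e :: w) (∑ e, f e) := by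
    rw [transport_cons, transport_cons]
    apply transport_mono
    rw [strip_total hf, add_comm]
    exact strip_le hf _ _
  have h2 : transport tl hd col f (e :: w) 0 ≤
      transport tl hd col f (e :: w) (transport tl hd col f u 0) := by
    rw [transport_cons, transport_cons]
    apply transport_mono
    rw [strip_zero hf]
    exact inShift_le_strip _ _
  linarith

theorem width_le_of_infix {u w : List E} (hu : u ≠ []) (h : u <:+: w) :
    width tl hd col f w ≤ width tl hd col f u := by
  obtain ⟨P, Q, rfl⟩ := h
  obtain ⟨e, u, rfl⟩ := List.exists_cons_of_ne_nil hu
  exact (width_append_le_left hf _ _).trans (width_append_le_right hf _ _ _)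

end Transport

section Vertex

variable [Fintype E] [DecidableEq V] {tl hd : E → V} {col : E → Col} {f : E → ℝ}

theorem outShift_blue {e : E} (h : col e = .blue) : outShift tl col f e = 0 := by
  simp [outShift, h]

theorem inShift_blue {e : E} (h : col e = .blue) : inShift hd col f e = 0 := by
  simp [inShift, h]

theorem outShift_red (hfr : CyclicAmpleFraming tl hd col) {b r : E}
    (hv : IsInternal tl hd (tl r)) (hr : col r = .red) (hb : col b = .blue) (h : tl b = tl r) :
    outShift tl col f r = f b := by
  rw [outShift, if_pos hr, ← Finset.sum_singleton f b]
  congr 1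
  ext x
  simp only [Finset.mem_filter, Finset.mem_univ, true_and, Finset.mem_singleton]
  refine ⟨fun hx => hfr.eq_of_tl_eq hv hx.1 h (hx.2.trans hb.symm), ?_⟩
  rintro rfl
  exact ⟨h, hb⟩

theorem inShift_red (hfr : CyclicAmpleFraming tl hd col) {b r : E}
    (hv : IsInternal tl hd (hd r)) (hr : col r = .red) (hb : col b = .blue) (h : hd b = hd r) :
    inShift hd col f r = f b := by
  rw [inShift, if_pos hr, ← Finset.sum_singleton f b]
  congr 1
  ext x
  simp only [Finset.mem_filter, Finset.mem_univ, true_and, Finset.mem_singleton]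
  refine ⟨fun hx => hfr.eq_of_hd_eq hv hx.1 h (hx.2.trans hb.symm), ?_⟩
  rintro rfl
  exact ⟨h, hb⟩

/-- At every internal vertex, the flow on the incoming edges equals that on the outgoing edges. -/
theorem balance_eq (hbal : ∀ v : V, IsInternal tl hd v → netflowR tl hd f v = 0)
    {v : V} (hv : IsInternal tl hd v) {b r b' r' : E} (hbr : b ≠ r) (hbr' : b' ≠ r')
    (hin : ∀ e, hd e = v ↔ e = b ∨ e = r) (hout : ∀ e, tl e = v ↔ e = b' ∨ e = r') :
    f b + f r = f b' + f r' := by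
  classical
  have h := hbal v hv
  have h1 : Finset.univ.filter (fun e => tl e = v) = {b', r'} := by
    ext e; simp [hout]
  have h2 : Finset.univ.filter (fun e => hd e = v) = {b, r} := by
    ext e; simp [hin]
  rw [netflowR, h1, h2, Finset.sum_pair hbr, Finset.sum_pair hbr'] at h
  linarith

variable (hfr : CyclicAmpleFraming tl hd col) (hf : ∀ e, 0 ≤ f e)
  (hbal : ∀ v : V, IsInternal tl hd v → netflowR tl hd f v = 0)
include hfr hf hbal

theorem width_concat_add {w : List E} {v : V} (hw : w ≠ []) (hwv : hd (w.getLast hw) = v)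
    (hv : IsInternal tl hd v) {b r : E} (hb : tl b = v) (hbc : col b = .blue) (hr : tl r = v)
    (hrc : col r = .red) (hbr : b ≠ r) (hall : ∀ e, tl e = v ↔ e = b ∨ e = r) :
    width tl hd col f (w ++ [b]) + width tl hd col f (w ++ [r]) = width tl hd col f w := by
  obtain ⟨b', r', hb', hbc', hr', hrc', hbr', hall'⟩ := hfr.exists_in hv
  have hB := balance_eq hbal hv hbr' hbr hall' hall
  obtain ⟨w', e, rfl⟩ : ∃ w' e, w = w' ++ [e] :=
    ⟨w.dropLast, w.getLast hw, (List.dropLast_append_getLast hw).symm⟩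
  rw [List.getLast_append_singleton] at hwv
  have key (y : ℝ) : strip tl hd col f (strip tl hd col f y e) b +
      strip tl hd col f (strip tl hd col f y e) r =
      strip tl hd col f y e + inShift hd col f b + inShift hd col f r := by
    have h1 := inShift_le_strip (tl := tl) (hd := hd) (col := col) (f := f) e y
    have h2 := strip_le (tl := tl) (hd := hd) (col := col) hf e y
    have h3 : 0 ≤ inShift hd col f e ∧ inShift hd col f e + f e ≤ f b + f r := by
      rcases (hall' e).1 hwv with rfl | rfl
      · rw [inShift_blue hbc']
        exact ⟨le_rfl, by linarith [hf r']⟩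
      · rw [inShift_red hfr (hr' ▸ hv) hrc' hbc' (hb'.trans hr'.symm)]
        exact ⟨hf _, by linarith⟩
    generalize strip tl hd col f y e = z at *
    rw [strip, strip, outShift_blue hbc, outShift_red hfr (hr ▸ hv) hrc hbc (hb.trans hr.symm),
      sub_zero]
    have := hf b
    have := hf r
    have h5 : max 0 (min (f b) z) = min (f b) z :=
      max_eq_right (le_min (hf b) (by linarith))
    have h6 : min (f r) (z - f b) = z - f b := min_eq_right (by linarith)
    rw [h5, h6]
    rcases min_cases (f b) z with h | h <;> rcases max_cases 0 (z - f b) with h' | h' <;> linarith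
  have k1 := key (transport tl hd col f w' (∑ e, f e))
  have k2 := key (transport tl hd col f w' 0)
  simp only [width, transport_concat]
  linarith

theorem width_cons_add {w : List E} {e : E} {v : V} (hev : tl e = v)
    (hv : IsInternal tl hd v) {b r : E} (hb : hd b = v) (hbc : col b = .blue) (hr : hd r = v)
    (hrc : col r = .red) (hbr : b ≠ r) (hall : ∀ e, hd e = v ↔ e = b ∨ e = r) :
    width tl hd col f (b :: e :: w) + width tl hd col f (r :: e :: w) =
      width tl hd col f (e :: w) := by
  obtain ⟨b', r', hb', hbc', hr', hrc', hbr', hall'⟩ := hfr.exists_out hv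
  have hB := balance_eq hbal hv hbr hbr' hall hall'
  have hs : strip tl hd col f (f r + f b) e = f e + inShift hd col f e := by
    apply strip_of_le hf
    rcases (hall' e).1 hev with rfl | rfl
    · rw [outShift_blue hbc']; linarith [hf r']
    · rw [outShift_red hfr (hr' ▸ hv) hrc' hbc' (hb'.trans hr'.symm)]; linarith
  simp only [width, transport_cons]
  rw [strip_total hf, strip_total hf, strip_zero hf, strip_zero hf, strip_total hf,
    inShift_blue hbc, inShift_red hfr (hr ▸ hv) hrc hbc (hb.trans hr.symm), hs, add_zero]
  ring

end Vertex

section Bands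

variable [Fintype E] [DecidableEq V] {tl hd : E → V} {col : E → Col} {f : E → ℝ}

/-- Two bands of positive width cannot cross. -/
theorem not_crossing_of_width_pos (hfr : CyclicAmpleFraming tl hd col) (hf : ∀ e, 0 ≤ f e)
    {p q p' q' : E} {S : List E}
    (h : Composable tl hd (p :: (S ++ [q]))) (h' : Composable tl hd (p' :: (S ++ [q'])))
    (hp : hd p = hd p') (hpc : col p = .blue) (hqc' : col q' = .blue) (hqc : col q = .red)
    (hpc' : col p' = .red) (hw : 0 < width tl hd col f (p :: (S ++ [q])))
    (hw' : 0 < width tl hd col f (p' :: (S ++ [q']))) : False := by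
  have e1 : outShift tl col f q = f q' :=
    outShift_red hfr h.isInternal_tl hqc hqc' (h.tl_eq_tl h' hp).symm
  have e2 : inShift hd col f p' = f p := inShift_red hfr h'.isInternal_hd hpc' hpc hp
  rw [width, transport_cons, transport_cons, transport_concat, transport_concat, strip_total hf,
    inShift_blue hpc, add_zero] at hw
  rw [width, transport_cons, transport_cons, transport_concat, transport_concat, strip_zero hf,
    e2] at hw'
  generalize transport tl hd col f S (f p) = y at *
  have h1 := inShift_le_strip (tl := tl) (hd := hd) (col := col) (f := f) q
    (transport tl hd col f S (strip tl hd col f 0 p))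
  have h2 := strip_le (tl := tl) (hd := hd) (col := col) hf q'
    (transport tl hd col f S (strip tl hd col f (∑ e, f e) p'))
  have h3 : 0 < max 0 (min (f q) (y - f q')) := by
    have : strip tl hd col f y q = max 0 (min (f q) (y - f q')) + inShift hd col f q := by
      rw [strip, e1]
    linarith
  have h4 : max 0 (min (f q') y) < f q' := by
    have : strip tl hd col f y q' = max 0 (min (f q') y) + inShift hd col f q' := by
      rw [strip, outShift_blue hqc', sub_zero]
    linarith
  have h5 : 0 < y - f q' := by
    by_contra hc
    rw [max_eq_left ((min_le_right _ _).trans (not_lt.1 hc))] at h3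
    exact lt_irrefl _ h3
  rw [min_eq_left (by linarith)] at h4
  linarith [le_max_right 0 (f q')]

theorem not_incompat_of_width_pos (hfr : CyclicAmpleFraming tl hd col) (hf : ∀ e, 0 ≤ f e)
    {ρ σ : List E} (hρ : 0 < width tl hd col f ρ) (hσ : 0 < width tl hd col f σ) :
    ¬ Incompat tl hd col ρ σ := by
  rintro ⟨h1, h2, P, S, Q, P', Q', p, q, p', q', hdec, hp, hpc, hqc', hqc, hpc'⟩
  have key {ρ σ : List E} (h1 : Composable tl hd ρ) (h2 : Composable tl hd σ)
      (hρ : 0 < width tl hd col f ρ) (hσ : 0 < width tl hd col f σ)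
      (e1 : ρ = P ++ p :: (S ++ q :: Q)) (e2 : σ = P' ++ p' :: (S ++ q' :: Q')) : False := by
    have i1 : p :: (S ++ [q]) <:+: ρ := ⟨P, Q, by simp [e1]⟩
    have i2 : p' :: (S ++ [q']) <:+: σ := ⟨P', Q', by simp [e2]⟩
    exact not_crossing_of_width_pos hfr hf (h1.infix i1) (h2.infix i2) hp hpc hqc' hqc hpc'
      (hρ.trans_le (width_le_of_infix hf (by simp) i1))
      (hσ.trans_le (width_le_of_infix hf (by simp) i2))
  rcases hdec with ⟨e1, e2⟩ | ⟨e1, e2⟩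
  exacts [key h1.composable h2.composable hρ hσ e1 e2, key h2.composable h1.composable hσ hρ e1 e2]

open Classical in
/-- If every minimal cycle has an edge without flow, then the band along a walk is divided into
the bands along the good routes containing this walk. -/
theorem width_eq_sum [Fintype {w : List E // IsGoodRoute tl hd w}]
    (hfr : CyclicAmpleFraming tl hd col) (hf : ∀ e, 0 ≤ f e)
    (hbal : ∀ v : V, IsInternal tl hd v → netflowR tl hd f v = 0)
    (hz : ∀ w, IsMinCycle tl hd w → ∃ e ∈ w, f e = 0) (n : ℕ) {w : List E} (hne : w ≠ [])
    (hw : Composable tl hd w) (hn : Fintype.card E + 1 ≤ w.length + n) :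
    width tl hd col f w =
      ∑ ρ : {w : List E // IsGoodRoute tl hd w}, if w <:+: ρ.1 then width tl hd col f ρ.1 else 0 := by
  induction n generalizing w with
  | zero =>
    have hnd : ¬ w.Nodup := fun h => by have := h.length_le_card; omega
    have hcyc : ∃ u, u <:+: w ∧ IsMinCycle tl hd u := by
      by_contra! hc
      exact hnd (nodup_map_hd_of_forall_not_isMinCycle hw hc).of_map
    obtain ⟨u, hu, hc⟩ := hcyc
    obtain ⟨e, he, h0⟩ := hz u hc
    rw [width_eq_zero_of_mem (hu.subset he) h0, Finset.sum_eq_zero]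
    intro ρ _
    rw [if_neg]
    exact fun h => hnd (h.sublist.nodup ρ.2.nodup)
  | succ n ih =>
    by_cases hv : IsInternal tl hd (hd (w.getLast hne))
    · obtain ⟨b, r, hb, hbc, hr, hrc, hbr, hall⟩ := hfr.exists_out hv
      rw [← width_concat_add hfr hf hbal hne rfl hv hb hbc hr hrc hbr hall,
        ih (by simp) (composable_concat hne hw hb.symm) (by simp; omega),
        ih (by simp) (composable_concat hne hw hr.symm) (by simp; omega),
        ← Finset.sum_add_distrib]
      refine Finset.sum_congr rfl fun ρ _ => ?_
      by_cases hi : w <:+: ρ.1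
      · obtain ⟨e, he⟩ := ρ.2.1.exists_concat_infix hne hi hv.2
        have hnot : ¬ (w ++ [b] <:+: ρ.1 ∧ w ++ [r] <:+: ρ.1) := fun h =>
          hbr (ρ.2.eq_of_tl_eq (h.1.subset (by simp)) (h.2.subset (by simp)) (hb.trans hr.symm))
        have hor : w ++ [b] <:+: ρ.1 ∨ w ++ [r] <:+: ρ.1 := by
          have := Composable.hd_getLast (ρ.2.composable.infix he) hne
          rcases (hall e).1 this.symm with rfl | rfl
          exacts [Or.inl he, Or.inr he]
        rcases hor with h | h
        · rw [if_pos h, if_neg fun h' => hnot ⟨h, h'⟩, if_pos hi, add_zero]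
        · rw [if_pos h, if_neg fun h' => hnot ⟨h', h⟩, if_pos hi, zero_add]
      · rw [if_neg hi, if_neg, if_neg, add_zero]
        exacts [fun h => hi ((List.prefix_append _ _).isInfix.trans h),
          fun h => hi ((List.prefix_append _ _).isInfix.trans h)]
    have hsink : IsSink tl hd (hd (w.getLast hne)) := by
      by_contra h
      exact hv ⟨fun hs => hs _ rfl, h⟩
    obtain ⟨x, w, rfl⟩ := List.exists_cons_of_ne_nil hne
    by_cases hv : IsInternal tl hd (tl x)
    · obtain ⟨b, r, hb, hbc, hr, hrc, hbr, hall⟩ := hfr.exists_in hv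
      rw [← width_cons_add hfr hf hbal rfl hv hb hbc hr hrc hbr hall,
        ih (by simp) (List.isChain_cons_cons.2 ⟨hb, hw⟩) (by simp at hn ⊢; omega),
        ih (by simp) (List.isChain_cons_cons.2 ⟨hr, hw⟩) (by simp at hn ⊢; omega),
        ← Finset.sum_add_distrib]
      refine Finset.sum_congr rfl fun ρ _ => ?_
      by_cases hi : x :: w <:+: ρ.1
      · obtain ⟨e, he⟩ := ρ.2.1.exists_cons_infix hi hv.1
        have hnot : ¬ (b :: x :: w <:+: ρ.1 ∧ r :: x :: w <:+: ρ.1) := fun h =>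
          hbr (ρ.2.eq_of_hd_eq (h.1.subset (by simp)) (h.2.subset (by simp)) (hb.trans hr.symm))
        have hor : b :: x :: w <:+: ρ.1 ∨ r :: x :: w <:+: ρ.1 := by
          have := List.isChain_cons_cons.1 (ρ.2.composable.infix he)
          rcases (hall e).1 this.1 with rfl | rfl
          exacts [Or.inl he, Or.inr he]
        rcases hor with h | h
        · rw [if_pos h, if_neg fun h' => hnot ⟨h, h'⟩, if_pos hi, add_zero]
        · rw [if_pos h, if_neg fun h' => hnot ⟨h', h⟩, if_pos hi, zero_add]
      · rw [if_neg hi, if_neg, if_neg, add_zero]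
        exacts [fun h => hi ((List.suffix_cons _ _).isInfix.trans h),
          fun h => hi ((List.suffix_cons _ _).isInfix.trans h)]
    have hsource : IsSource tl hd (tl x) := by
      by_contra h
      exact hv ⟨h, fun hs => hs _ rfl⟩
    have hss : IsSrcSnkWalk tl hd (x :: w) := by
      refine ⟨⟨hne, hw⟩, by simpa using hsource, fun e he => ?_⟩
      rw [List.getLast?_eq_getLast_of_ne_nil hne] at he
      have : (x :: w).getLast hne = e := by simpa using he
      exact this ▸ hsink
    by_cases hg : ∃ u, u <:+: x :: w ∧ IsMinCycle tl hd u
    · obtain ⟨u, hu, hc⟩ := hg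
      obtain ⟨e, he, h0⟩ := hz u hc
      rw [width_eq_zero_of_mem (hu.subset he) h0, Finset.sum_eq_zero]
      intro ρ _
      rw [if_neg]
      exact fun h => ρ.2.2 u (hu.trans h) hc
    · have hg : IsGoodRoute tl hd (x :: w) := ⟨hss, fun u hu hc => hg ⟨u, hu, hc⟩⟩
      rw [Finset.sum_eq_single ⟨x :: w, hg⟩, if_pos (List.infix_refl _)]
      · intro ρ _ hρ
        rw [if_neg]
        exact fun h => hρ (Subtype.ext (ρ.2.eq_of_infix hg h))
      · simp

open Classical in
theorem eq_sum_width [Fintype {w : List E // IsGoodRoute tl hd w}]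
    (hfr : CyclicAmpleFraming tl hd col) (hf : ∀ e, 0 ≤ f e)
    (hbal : ∀ v : V, IsInternal tl hd v → netflowR tl hd f v = 0)
    (hz : ∀ w, IsMinCycle tl hd w → ∃ e ∈ w, f e = 0) (e : E) :
    f e = ∑ ρ : {w : List E // IsGoodRoute tl hd w},
      if e ∈ ρ.1 then width tl hd col f ρ.1 else 0 := by
  rw [← width_singleton (tl := tl) (hd := hd) (col := col) hf e,
    width_eq_sum hfr hf hbal hz (Fintype.card E) (by simp) (by simp) (by simp [add_comm])]
  simp only [List.singleton_infix_iff]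

end Bands

section Deviation

variable {tl hd : E → V} {col : E → Col}

/-- The walk `σ` joins a final segment of `w` through an edge of colour `c`, whereas `w` itself
enters this segment through an edge of the other colour. -/
def Deviates (hd : E → V) (col : E → Col) (c : Col) (w σ : List E) : Prop :=
  ∃ p p' S, p :: S <:+ w ∧ p' :: S <:+: σ ∧ hd p = hd p' ∧ col p' = c ∧ col p ≠ c

variable {w ρ σ τ : List E} {c : Col} {e : E}

theorem not_deviates_nil : ¬ Deviates hd col c [] σ := by
  rintro ⟨p, p', S, h, -⟩
  simpa using h.sublist.length_le

theorem deviates_concat_iff (hσ : IsGoodRoute tl hd σ) (hc : Composable tl hd (w ++ [e])) :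
    Deviates hd col c (w ++ [e]) σ ↔ Deviates hd col c w σ ∧ e ∈ σ ∨
      col e ≠ c ∧ ∃ p ∈ σ, hd p = hd e ∧ col p = c := by
  constructor
  · rintro ⟨p, p', S, h1, h2, h3, h4, h5⟩
    rcases List.suffix_concat_iff.1 h1 with h | ⟨t, ht, htw⟩
    · simp at h
    cases t with
    | nil =>
      obtain ⟨rfl, rfl⟩ : p = e ∧ S = [] := by simpa using ht
      exact Or.inr ⟨h5, p', h2.subset (by simp), h3.symm, h4⟩
    | cons x t =>
      obtain ⟨rfl, rfl⟩ : p = x ∧ S = t ++ [e] := by simpa using ht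
      refine Or.inl ⟨⟨p, p', t, htw, ?_, h3, h4, h5⟩, h2.subset (by simp)⟩
      exact (List.prefix_append (p' :: t) [e]).isInfix.trans h2
  · rintro (⟨⟨p, p', S, h1, h2, h3, h4, h5⟩, he⟩ | ⟨h1, p, hp, h2, h3⟩)
    · have h6 : p :: (S ++ [e]) <:+ w ++ [e] := by
        obtain ⟨t, rfl⟩ := h1
        exact ⟨t, by simp⟩
      refine ⟨p, p', S ++ [e], h6, ?_, h3, h4, h5⟩
      have h7 : Composable tl hd (p :: (S ++ [e])) := hc.infix h6.isInfix
      exact hσ.concat_infix (by simp) h2 he (h7.cons_congr h3)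
    · exact ⟨e, p, [], List.suffix_append _ _, (List.singleton_infix_iff _ _).2 hp, h2.symm, h3, h1⟩

theorem IsGoodRoute.concat_infix_iff (hσ : IsGoodRoute tl hd σ) (hw : w ≠ [])
    (hc : Composable tl hd (w ++ [e])) : w ++ [e] <:+: σ ↔ w <:+: σ ∧ e ∈ σ :=
  ⟨fun h => ⟨(List.prefix_append _ _).isInfix.trans h, h.subset (by simp)⟩,
    fun h => hσ.concat_infix hw h.1 h.2 hc⟩

/-- A good route through the final vertex of a walk from a source either contains this walk or
deviates from it. -/
theorem infix_or_deviates (hfr : CyclicAmpleFraming tl hd col) (hσ : IsGoodRoute tl hd σ)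
    (hne : w ≠ []) (hw : Composable tl hd w)
    (hv : IsInternal tl hd (hd (w.getLast hne))) {y : E} (hy : y ∈ σ)
    (hyv : hd y = hd (w.getLast hne)) : w <:+: σ ∨ ∃ c, Deviates hd col c w σ := by
  induction w using List.reverseRecOn generalizing y with
  | nil => exact absurd rfl hne
  | append_singleton w e ih =>
    rw [List.getLast_append_singleton] at hyv hv
    by_cases hye : y = e
    · subst hye
      cases hw0 : w with
      | nil => exact Or.inl ((List.singleton_infix_iff _ _).2 hy)
      | cons x t =>
        rw [← hw0]
        have hne' : w ≠ [] := by simp [hw0]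
        have hl := hw.hd_getLast hne'
        have hv' := isInternal_of_hd_eq_tl hl
        obtain ⟨z, hz⟩ := hσ.1.exists_cons_infix ((List.singleton_infix_iff _ _).2 hy)
          (hl ▸ hv'.1)
        have hzy := (List.isChain_cons_cons.1 (hσ.composable.infix hz)).1
        rcases ih hne' (hw.infix (List.prefix_append _ _).isInfix) hv' (hz.subset (by simp))
          (hzy.trans hl.symm) with h | ⟨c, h⟩
        · exact Or.inl ((hσ.concat_infix_iff hne' hw).2 ⟨h, hy⟩)
        · exact Or.inr ⟨c, (deviates_concat_iff hσ hw).2 (Or.inl ⟨h, hy⟩)⟩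
    · refine Or.inr ⟨col y, (deviates_concat_iff hσ hw).2 (Or.inr ⟨fun hc => ?_, y, hy, hyv, rfl⟩)⟩
      exact hye (hfr.eq_of_hd_eq hv hyv rfl hc.symm)

theorem not_deviates_self (hσ : IsGoodRoute tl hd σ) : ¬ Deviates hd col c σ σ := by
  rintro ⟨p, p', S, h1, h2, h3, h4, h5⟩
  have := hσ.eq_of_hd_eq (h1.subset (by simp)) (h2.subset (by simp)) h3
  exact h5 (this ▸ h4)

theorem incompat_of_infix (hρ : IsSrcSnkWalk tl hd ρ) (hσ : IsSrcSnkWalk tl hd σ)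
    {p q p' q' : E} {S : List E} (h : p :: (S ++ [q]) <:+: ρ) (h' : p' :: (S ++ [q']) <:+: σ)
    (hp : hd p = hd p') (hpc : col p = .blue) (hqc' : col q' = .blue) (hqc : col q = .red)
    (hpc' : col p' = .red) : Incompat tl hd col ρ σ := by
  obtain ⟨P, Q, rfl⟩ := h
  obtain ⟨P', Q', rfl⟩ := h'
  exact ⟨hρ, hσ, P, S, Q, P', Q', p, q, p', q', Or.inl ⟨by simp, by simp⟩, hp, hpc, hqc', hqc,
    hpc'⟩

theorem Deviates.concat_infix (hσ : IsGoodRoute tl hd σ) (hτ : IsGoodRoute tl hd τ)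
    (hne : w ≠ []) (h : Deviates hd col c w σ) (hw : w <:+: τ) {x y : E} (hx : x ∈ σ) (hy : y ∈ τ)
    (hxv : hd (w.getLast hne) = tl x) (hyv : hd (w.getLast hne) = tl y) :
    ∃ p p' S, p' :: (S ++ [x]) <:+: σ ∧ p :: (S ++ [y]) <:+: τ ∧ hd p = hd p' ∧ col p' = c ∧
      col p ≠ c := by
  have hcx := composable_concat hne (hτ.composable.infix hw) hxv
  have hcy := composable_concat hne (hτ.composable.infix hw) hyv
  obtain ⟨p, p', S, ⟨t, rfl⟩, h2, h3, h4, h5⟩ := h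
  have i1 : Composable tl hd (p :: (S ++ [x])) := hcx.infix ⟨t, [], by simp⟩
  have i2 : Composable tl hd (p :: (S ++ [y])) := hcy.infix ⟨t, [], by simp⟩
  exact ⟨p, p', S, hσ.concat_infix (by simp) h2 hx (i1.cons_congr h3),
    hτ.concat_infix (by simp) ((List.suffix_append _ _).isInfix.trans hw) hy i2, h3, h4, h5⟩

theorem Deviates.incompat_of_blue (hσ : IsGoodRoute tl hd σ) (hτ : IsGoodRoute tl hd τ)
    (hne : w ≠ []) (h : Deviates hd col .blue w σ) (hw : w <:+: τ) {x y : E} (hx : x ∈ σ)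
    (hy : y ∈ τ) (hxv : hd (w.getLast hne) = tl x) (hyv : hd (w.getLast hne) = tl y)
    (hxc : col x = .red) (hyc : col y = .blue) : Incompat tl hd col σ τ := by
  obtain ⟨p, p', S, h1, h2, h3, h4, h5⟩ := h.concat_infix hσ hτ hne hw hx hy hxv hyv
  refine incompat_of_infix hσ.1 hτ.1 h1 h2 h3.symm h4 hyc hxc ?_
  cases hp : col p <;> simp_all

theorem Deviates.incompat_of_red (hσ : IsGoodRoute tl hd σ) (hτ : IsGoodRoute tl hd τ)
    (hne : w ≠ []) (h : Deviates hd col .red w σ) (hw : w <:+: τ) {x y : E} (hx : x ∈ σ)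
    (hy : y ∈ τ) (hxv : hd (w.getLast hne) = tl x) (hyv : hd (w.getLast hne) = tl y)
    (hxc : col x = .blue) (hyc : col y = .red) : Incompat tl hd col τ σ := by
  obtain ⟨p, p', S, h1, h2, h3, h4, h5⟩ := h.concat_infix hσ hτ hne hw hx hy hxv hyv
  refine incompat_of_infix hτ.1 hσ.1 h2 h1 h3 ?_ hxc hyc h4
  cases hp : col p <;> simp_all

theorem Deviates.exists_mem_tl (hσ : IsGoodRoute tl hd σ) (hne : w ≠ [])
    (h : Deviates hd col c w σ) (hv : ¬ IsSink tl hd (hd (w.getLast hne))) :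
    ∃ e ∈ σ, tl e = hd (w.getLast hne) := by
  obtain ⟨p, p', S, ⟨t, rfl⟩, h2, h3, -, -⟩ := h
  have hl : hd ((t ++ p :: S).getLast hne) = hd ((p' :: S).getLast (by simp)) := by
    rw [List.getLast_append_of_ne_nil _ (by simp)]
    cases S with
    | nil => exact h3
    | cons s S => simp
  rw [hl] at hv ⊢
  obtain ⟨e, he⟩ := hσ.1.exists_concat_infix (by simp) h2 hv
  exact ⟨e, he.subset (by simp), (Composable.hd_getLast (hσ.composable.infix he) (by simp)).symm⟩

end Deviation

section Weights

open Classical in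
/-- The total weight of the elements satisfying `D`. -/
noncomputable def weight {ι : Type*} [Fintype ι] (a : ι → ℝ) (D : ι → Prop) : ℝ :=
  ∑ i, if D i then a i else 0

section Basic

variable {ι : Type*} [Fintype ι] {a : ι → ℝ} {D D' D'' : ι → Prop}

theorem weight_congr (h : ∀ i, D i ↔ D' i) : weight a D = weight a D' :=
  congrArg (weight a) (funext fun i => propext (h i))

theorem weight_congr_support (h : ∀ i, a i ≠ 0 → (D i ↔ D' i)) : weight a D = weight a D' := by
  classical
  refine Finset.sum_congr rfl fun i _ => ?_
  by_cases h0 : a i = 0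
  · rw [h0, ite_self, ite_self]
  · exact if_congr (h i h0) rfl rfl

theorem weight_nonneg (ha : ∀ i, 0 ≤ a i) : 0 ≤ weight a D :=
  Finset.sum_nonneg fun i _ => by split_ifs; exacts [ha i, le_rfl]

theorem weight_mono (ha : ∀ i, 0 ≤ a i) (h : ∀ i, D i → D' i) : weight a D ≤ weight a D' := by
  refine Finset.sum_le_sum fun i _ => ?_
  by_cases hi : D i
  · rw [if_pos hi, if_pos (h i hi)]
  · rw [if_neg hi]
    split_ifs
    exacts [ha i, le_rfl]

theorem weight_false : weight a (fun _ => False) = 0 := by simp [weight]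

theorem weight_add (h : ∀ i, D i ↔ D' i ∨ D'' i) (hd : ∀ i, D' i → ¬ D'' i) :
    weight a D = weight a D' + weight a D'' := by
  unfold weight
  rw [← Finset.sum_add_distrib]
  refine Finset.sum_congr rfl fun i _ => ?_
  by_cases h1 : D' i
  · rw [if_pos ((h i).2 (Or.inl h1)), if_pos h1, if_neg (hd i h1), add_zero]
  · by_cases h2 : D'' i
    · rw [if_pos ((h i).2 (Or.inr h2)), if_neg h1, if_pos h2, zero_add]
    · rw [if_neg (fun h3 => ((h i).1 h3).elim h1 h2), if_neg h1, if_neg h2, add_zero]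

theorem exists_of_weight_ne_zero (h : weight a D ≠ 0) : ∃ i, a i ≠ 0 ∧ D i := by
  by_contra! hc
  refine h ((weight_congr_support fun i hi => ?_).trans weight_false)
  simp [hc i hi]

end Basic

variable [Fintype E] [DecidableEq V] {tl hd : E → V} {col : E → Col} {f : E → ℝ}
  [Fintype {w : List E // IsGoodRoute tl hd w}] {a : {w : List E // IsGoodRoute tl hd w} → ℝ}

omit [Fintype E] [DecidableEq V] in
/-- A set of routes through an internal vertex which is closed downwards with respect to the
outgoing edges splits among these edges as prescribed by the flow. -/
theorem weight_out (ha : ∀ ρ, 0 ≤ a ρ) (hsum : ∀ e, f e = weight a fun ρ => e ∈ ρ.1) {b r : E}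
    (hbr : b ≠ r) (htl : tl b = tl r)
    {D : {w : List E // IsGoodRoute tl hd w} → Prop} (hD : ∀ ρ, D ρ → b ∈ ρ.1 ∨ r ∈ ρ.1)
    (hdown : ∀ ρ σ, a ρ ≠ 0 → a σ ≠ 0 → D ρ → r ∈ ρ.1 → b ∈ σ.1 → D σ) :
    weight a (fun ρ => D ρ ∧ b ∈ ρ.1) = max 0 (min (f b) (weight a D)) ∧
      weight a (fun ρ => D ρ ∧ r ∈ ρ.1) = max 0 (min (f r) (weight a D - f b)) := by
  have h1 : weight a D = weight a (fun ρ => D ρ ∧ b ∈ ρ.1) + weight a fun ρ => D ρ ∧ r ∈ ρ.1 := by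
    refine weight_add (fun ρ => ?_) fun ρ h h' => hbr (ρ.2.eq_of_tl_eq h.2 h'.2 htl)
    have := hD ρ
    tauto
  have h2 : weight a (fun ρ => D ρ ∧ b ∈ ρ.1) ≤ f b := by
    rw [hsum]; exact weight_mono ha fun ρ h => h.2
  have h3 : weight a (fun ρ => D ρ ∧ r ∈ ρ.1) ≤ f r := by
    rw [hsum]; exact weight_mono ha fun ρ h => h.2
  have h4 : 0 ≤ weight a (fun ρ => D ρ ∧ b ∈ ρ.1) := weight_nonneg ha
  have h5 : 0 ≤ weight a (fun ρ => D ρ ∧ r ∈ ρ.1) := weight_nonneg ha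
  have h6 : weight a (fun ρ => D ρ ∧ r ∈ ρ.1) = 0 ∨ weight a (fun ρ => D ρ ∧ b ∈ ρ.1) = f b := by
    by_cases h0 : weight a (fun ρ => D ρ ∧ r ∈ ρ.1) = 0
    · exact Or.inl h0
    · obtain ⟨ρ, hρ, hDρ, hr⟩ := exists_of_weight_ne_zero h0
      right
      rw [hsum]
      refine weight_congr_support fun σ hσ => ?_
      have := hdown ρ σ hρ hσ hDρ hr
      tauto
  rw [h1]
  generalize weight a (fun ρ => D ρ ∧ b ∈ ρ.1) = x at *
  generalize weight a (fun ρ => D ρ ∧ r ∈ ρ.1) = y at *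
  rcases h6 with h6 | h6
  · rw [h6, add_zero, min_eq_right h2, max_eq_right h4, max_eq_left]
    · exact ⟨rfl, rfl⟩
    · exact (min_le_right _ _).trans (by linarith)
  · rw [← h6, min_eq_left (by linarith), max_eq_right h4, add_sub_cancel_left, min_eq_right h3,
      max_eq_right h5]
    exact ⟨rfl, rfl⟩

theorem weight_blue_in (hsum : ∀ e, f e = weight a fun ρ => e ∈ ρ.1) (e : E) :
    weight a (fun ρ => col e ≠ .blue ∧ ∃ p ∈ ρ.1, hd p = hd e ∧ col p = .blue) =
      inShift hd col f e := by
  classical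
  cases hc : col e with
  | blue =>
    rw [inShift_blue hc, ← weight_false (a := a)]
    exact weight_congr fun ρ => by simp
  | red =>
    rw [inShift, if_pos hc]
    simp only [hsum, weight]
    rw [Finset.sum_comm]
    refine Finset.sum_congr rfl fun ρ _ => ?_
    by_cases h : ∃ p ∈ ρ.1, hd p = hd e ∧ col p = .blue
    · rw [if_pos ⟨by simp, h⟩]
      obtain ⟨p, hp, hpe, hpc⟩ := h
      rw [Finset.sum_eq_single p, if_pos hp]
      · intro x hx hxp
        rw [if_neg]
        intro hxρ
        simp only [Finset.mem_filter] at hx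
        exact hxp (ρ.2.eq_of_hd_eq hxρ hp (hx.2.1.trans hpe.symm))
      · simp [hpe, hpc]
    · rw [if_neg (fun h' => h h'.2), Finset.sum_eq_zero]
      intro x hx
      rw [if_neg]
      simp only [Finset.mem_filter] at hx
      exact fun hxρ => h ⟨x, hxρ, hx.2⟩

theorem weight_concat (hsum : ∀ e, f e = weight a fun ρ => e ∈ ρ.1) (e : E)
    {D D' : {w : List E // IsGoodRoute tl hd w} → Prop}
    (hD' : ∀ ρ, D' ρ ↔ D ρ ∧ e ∈ ρ.1 ∨
      (col e ≠ .blue ∧ ∃ p ∈ ρ.1, hd p = hd e ∧ col p = .blue)) :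
    weight a D' = weight a (fun ρ => D ρ ∧ e ∈ ρ.1) + inShift hd col f e := by
  rw [← weight_blue_in hsum]
  refine weight_add hD' ?_
  rintro ρ ⟨-, he⟩ ⟨hc, p, hp, hpe, hpc⟩
  exact hc (ρ.2.eq_of_hd_eq he hp hpe.symm ▸ hpc)

/-- The band along an initial segment of a route in a clique consists of the routes containing
this segment, and it lies above the routes joining it from a blue edge. -/
theorem transport_eq_weight (hfr : CyclicAmpleFraming tl hd col) (ha : ∀ ρ, 0 ≤ a ρ)
    (hK : ∀ ρ σ, a ρ ≠ 0 → a σ ≠ 0 → ¬ Incompat tl hd col ρ.1 σ.1)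
    (hsum : ∀ e, f e = weight a fun ρ => e ∈ ρ.1)
    (π : {w : List E // IsGoodRoute tl hd w}) (hπ : a π ≠ 0) {w : List E} (hw : w <+: π.1)
    (hne : w ≠ []) :
    transport tl hd col f w 0 = weight a (fun ρ => Deviates hd col .blue w ρ.1) ∧
      transport tl hd col f w (∑ e, f e) =
        weight a (fun ρ => Deviates hd col .blue w ρ.1 ∨ w <:+: ρ.1) := by
  have hf (e : E) : 0 ≤ f e := by rw [hsum]; exact weight_nonneg ha
  induction w using List.reverseRecOn with
  | nil => exact absurd rfl hne
  | append_singleton w e ih =>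
    have hcomp : Composable tl hd (w ++ [e]) := π.2.composable.infix hw.isInfix
    have heπ : e ∈ π.1 := hw.subset (by simp)
    rcases eq_or_ne w [] with rfl | hne'
    · rw [transport_concat, transport_concat]
      change strip tl hd col f 0 e = _ ∧ strip tl hd col f (∑ e, f e) e = _
      rw [strip_zero hf, strip_total hf]
      constructor
      · rw [weight_concat hsum e (col := col) (D := fun _ => False)]
        · simp [weight_false]
        · exact fun ρ => by rw [deviates_concat_iff ρ.2 hcomp]; simp [not_deviates_nil]
      · rw [weight_concat hsum e (col := col) (D := fun _ => True)]
        · simp [hsum]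
        · intro ρ
          rw [deviates_concat_iff ρ.2 hcomp, List.nil_append, List.singleton_infix_iff]
          simpa [not_deviates_nil] using or_comm
    · obtain ⟨ih1, ih2⟩ := ih ((List.prefix_append _ _).trans hw) hne'
      have hwe := hcomp.hd_getLast hne'
      have hwπ : w <:+: π.1 := ((List.prefix_append _ _).trans hw).isInfix
      have hv := isInternal_of_hd_eq_tl hwe
      obtain ⟨b, r, hb, hbc, hr, hrc, hbr, hall⟩ := hfr.exists_out hv
      have hebr := (hall e).1 hwe.symm
      have through {T : List E} {ρ : List E} (hρ : IsGoodRoute tl hd ρ)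
          (h : ∃ x ∈ ρ, tl x = hd (w.getLast hne')) : b ∈ ρ ∨ r ∈ ρ := by
        obtain ⟨x, hx, hxv⟩ := h
        rcases (hall x).1 hxv with rfl | rfl
        exacts [Or.inl hx, Or.inr hx]
      have down_aux (ρ σ) (hρ : a ρ ≠ 0) (hσ : a σ ≠ 0)
          (h : Deviates hd col .blue w ρ.1) (hrρ : r ∈ ρ.1)
          (h' : Deviates hd col .red w σ.1) (hbσ : b ∈ σ.1) : False := by
        rcases hebr with rfl | rfl
        · exact hK _ _ hρ hπ (h.incompat_of_blue ρ.2 π.2 hne' hwπ hrρ heπ hr.symm hwe hrc hbc)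
        · exact hK _ _ hπ hσ (h'.incompat_of_red σ.2 π.2 hne' hwπ hbσ heπ hb.symm hwe hbc hrc)
      have tri (σ : {w : List E // IsGoodRoute tl hd w}) (hbσ : b ∈ σ.1) :
          w <:+: σ.1 ∨ Deviates hd col .blue w σ.1 ∨ Deviates hd col .red w σ.1 := by
        obtain ⟨z, hz⟩ := σ.2.1.exists_cons_infix ((List.singleton_infix_iff _ _).2 hbσ)
          (hb ▸ hv.1)
        have hzb := (List.isChain_cons_cons.1 (σ.2.composable.infix hz)).1
        rcases infix_or_deviates hfr σ.2 hne' (π.2.composable.infix hwπ) hv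
          (hz.subset (by simp)) (hzb.trans hb) with h | ⟨c, h⟩
        · exact Or.inl h
        · cases c
          exacts [Or.inr (Or.inr h), Or.inr (Or.inl h)]
      have step {D : {w : List E // IsGoodRoute tl hd w} → Prop}
          (hD : ∀ ρ, D ρ → b ∈ ρ.1 ∨ r ∈ ρ.1)
          (hdown : ∀ ρ σ, a ρ ≠ 0 → a σ ≠ 0 → D ρ → r ∈ ρ.1 → b ∈ σ.1 → D σ) :
          strip tl hd col f (weight a D) e =
            weight a (fun ρ => D ρ ∧ e ∈ ρ.1) + inShift hd col f e := by
        obtain ⟨h1, h2⟩ := weight_out ha hsum hbr (hb.trans hr.symm) hD hdown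
        rcases hebr with rfl | rfl
        · rw [h1, strip, outShift_blue hbc, sub_zero]
        · rw [h2, strip, outShift_red hfr (hr ▸ hv) hrc hbc (hb.trans hr.symm)]
      have hdev (ρ : {w : List E // IsGoodRoute tl hd w}) (h : Deviates hd col .blue w ρ.1) :
          b ∈ ρ.1 ∨ r ∈ ρ.1 := through (T := w) ρ.2 (h.exists_mem_tl ρ.2 hne' hv.2)
      rw [transport_concat, transport_concat, ih1, ih2]
      constructor
      · rw [step hdev, weight_concat hsum e fun ρ => deviates_concat_iff ρ.2 hcomp]
        intro ρ σ hρ hσ h hrρ hbσ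
        rcases tri σ hbσ with h' | h' | h'
        · exact absurd (h.incompat_of_blue ρ.2 σ.2 hne' h' hrρ hbσ hr.symm hb.symm hrc hbc)
            (hK _ _ hρ hσ)
        · exact h'
        · exact (down_aux ρ σ hρ hσ h hrρ h' hbσ).elim
      · rw [step]
        · symm
          apply weight_concat hsum e
          intro ρ
          rw [deviates_concat_iff ρ.2 hcomp, ρ.2.concat_infix_iff hne' hcomp, or_right_comm,
            ← or_and_right]
        · rintro ρ (h | h)
          · exact hdev ρ h
          · obtain ⟨x, hx⟩ := ρ.2.1.exists_concat_infix hne' h hv.2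
            exact through (T := w) ρ.2 ⟨x, hx.subset (by simp),
              (Composable.hd_getLast (ρ.2.composable.infix hx) hne').symm⟩
        · intro ρ σ hρ hσ h hrρ hbσ
          rcases tri σ hbσ with h' | h' | h'
          · exact Or.inr h'
          · exact Or.inl h'
          · rcases h with h | h
            · exact (down_aux ρ σ hρ hσ h hrρ h' hbσ).elim
            · exact absurd
                (h'.incompat_of_red σ.2 ρ.2 hne' h hbσ hrρ hb.symm hr.symm hbc hrc) (hK _ _ hρ hσ)

/-- The weight of a route in a clique is the width of its band. -/
theorem eq_width_of_ne_zero (hfr : CyclicAmpleFraming tl hd col) (ha : ∀ ρ, 0 ≤ a ρ)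
    (hK : ∀ ρ σ, a ρ ≠ 0 → a σ ≠ 0 → ¬ Incompat tl hd col ρ.1 σ.1)
    (hsum : ∀ e, f e = weight a fun ρ => e ∈ ρ.1)
    (π : {w : List E // IsGoodRoute tl hd w}) (hπ : a π ≠ 0) :
    a π = width tl hd col f π.1 := by
  obtain ⟨h1, h2⟩ := transport_eq_weight hfr ha hK hsum π hπ (List.prefix_refl _) π.2.1.1.1
  rw [width, h1, h2, weight_add (D' := fun ρ => Deviates hd col .blue π.1 ρ.1)
    (D'' := fun ρ => ρ = π), add_sub_cancel_left]
  · rw [weight, Finset.sum_eq_single π (fun ρ _ h => if_neg h)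
      fun h => absurd (Finset.mem_univ π) h, if_pos rfl]
  · refine fun ρ => or_congr Iff.rfl ⟨fun h => Subtype.ext (ρ.2.eq_of_infix π.2 h), ?_⟩
    rintro rfl
    exact List.infix_refl _
  · rintro ρ h rfl
    exact not_deviates_self ρ.2 h

/-- A flow without circulations along minimal cycles has only one decomposition into pairwise
compatible good routes. -/
theorem eq_width (hfr : CyclicAmpleFraming tl hd col)
    (hbal : ∀ v : V, IsInternal tl hd v → netflowR tl hd f v = 0)
    (hz : ∀ w, IsMinCycle tl hd w → ∃ e ∈ w, f e = 0) (ha : ∀ ρ, 0 ≤ a ρ)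
    (hK : ∀ ρ σ, a ρ ≠ 0 → a σ ≠ 0 → ¬ Incompat tl hd col ρ.1 σ.1)
    (hsum : ∀ e, f e = weight a fun ρ => e ∈ ρ.1)
    (π : {w : List E // IsGoodRoute tl hd w}) : a π = width tl hd col f π.1 := by
  classical
  have hf (e : E) : 0 ≤ f e := by rw [hsum]; exact weight_nonneg ha
  obtain ⟨e, w, hew⟩ := List.exists_cons_of_ne_nil π.2.1.1.1
  have h1 := (hsum e).symm.trans (eq_sum_width hfr hf hbal hz e)
  have hle (ρ) : a ρ ≤ width tl hd col f ρ.1 := by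
    by_cases h0 : a ρ = 0
    · exact h0 ▸ width_nonneg hf _
    · exact (eq_width_of_ne_zero hfr ha hK hsum ρ h0).le
  have h2 := (Finset.sum_eq_sum_iff_of_le fun ρ _ => by
    split_ifs
    exacts [hle ρ, le_rfl]).1 h1 π (Finset.mem_univ _)
  simpa [hew] using h2

end Weights

section Cycles

variable {tl hd : E → V} {col : E → Col} {w : List E}

theorem IsMinCycle.map_tl_perm (hw : IsMinCycle tl hd w) : (w.map tl).Perm (w.map hd) := by
  obtain ⟨⟨hne, hc⟩, hcl, -⟩ := hw
  obtain ⟨e, t, rfl⟩ := List.exists_cons_of_ne_nil hne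
  have h1 : hd ((e :: t).getLast hne) = tl e :=
    hcl _ (by rw [List.getLast?_eq_getLast_of_ne_nil hne]; simp) _ (by simp)
  have h2 : (e :: t).map hd = (e :: t).dropLast.map hd ++ [tl e] := by
    conv_lhs => rw [← List.dropLast_append_getLast hne, List.map_append]
    rw [List.map_singleton, h1]
  rw [Composable.map_tl hc, h2]
  exact (List.perm_append_singleton _ _).symm

theorem IsMinCycle.nodup (hw : IsMinCycle tl hd w) : w.Nodup := hw.2.2.of_map

theorem IsMinCycle.exists_tl_eq (hw : IsMinCycle tl hd w) {x : E} (hx : x ∈ w) :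
    ∃ y ∈ w, tl y = hd x :=
  List.mem_map.1 (hw.map_tl_perm.mem_iff.2 (List.mem_map_of_mem hx))

theorem Composable.forall_mem {p : E → Prop} {x : E} {l : List E}
    (h : Composable tl hd (x :: l)) (hp : ∀ y z, z ∈ l → p y → hd y = tl z → p z) (hx : p x) :
    ∀ y ∈ x :: l, p y := by
  induction l generalizing x with
  | nil => simpa
  | cons y l ih =>
    obtain ⟨h1, h2⟩ := List.isChain_cons_cons.1 h
    have := ih h2 (fun u v hv => hp u v (List.mem_cons_of_mem _ hv)) (hp x y (by simp) hx h1)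
    exact List.forall_mem_cons.2 ⟨hx, this⟩

/-- A property of edges which is inherited by successors holds on the whole of a cycle once it
holds somewhere on it. -/
theorem IsMinCycle.forall_mem (hw : IsMinCycle tl hd w) {p : E → Prop}
    (hp : ∀ y z, z ∈ w → p y → hd y = tl z → p z) {x : E} (hxw : x ∈ w) (hx : p x) :
    ∀ y ∈ w, p y := by
  obtain ⟨⟨hne, hc⟩, hcl, -⟩ := hw
  obtain ⟨P, Q, hPQ⟩ := List.append_of_mem hxw
  have h1 : Composable tl hd (x :: Q) := List.IsChain.infix hc ⟨P, [], by simp [hPQ]⟩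
  have h2 := h1.forall_mem (fun y z hz => hp y z (by simp [hPQ, hz])) hx
  obtain ⟨e, t, rfl⟩ := List.exists_cons_of_ne_nil hne
  have h3 : p ((e :: t).getLast hne) := by
    apply h2
    have : (e :: t).getLast hne = (x :: Q).getLast (by simp) := by
      simp only [hPQ]
      rw [List.getLast_append_of_ne_nil _ (by simp)]
    rw [this]
    exact List.getLast_mem _
  have h4 : hd ((e :: t).getLast hne) = tl e :=
    hcl _ (by rw [List.getLast?_eq_getLast_of_ne_nil hne]; simp) _ (by simp)
  exact Composable.forall_mem hc (fun y z hz => hp y z (by simp [hz])) (hp _ e (by simp) h3 h4)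

theorem IsMinCycle.subset_of_mem (hfr : CyclicAmpleFraming tl hd col) {w' : List E}
    (hw : IsMinCycle tl hd w) (hw' : IsMinCycle tl hd w') {e : E} (he : e ∈ w) (he' : e ∈ w') :
    ∀ x ∈ w, x ∈ w' := by
  obtain ⟨c, hc⟩ := hfr.2 w hw
  obtain ⟨c', hc'⟩ := hfr.2 w' hw'
  have hcc : c = c' := (hc e he).symm.trans (hc' e he')
  refine hw.forall_mem (fun y z hz hy hyz => ?_) he he'
  obtain ⟨z', hz', hyz'⟩ := hw'.exists_tl_eq hy
  have : z = z' := hfr.eq_of_tl_eq (isInternal_of_hd_eq_tl hyz) hyz.symm hyz'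
    ((hc z hz).trans (hcc.trans (hc' z' hz').symm))
  exact this ▸ hz'

theorem IsCycleSet.nonempty [DecidableEq E] {C : Finset E} (hC : IsCycleSet tl hd C) :
    C.Nonempty := by
  obtain ⟨w, hw, rfl⟩ := hC
  obtain ⟨e, t, rfl⟩ := List.exists_cons_of_ne_nil hw.1.1
  exact ⟨e, by simp⟩

theorem IsCycleSet.eq_of_mem [DecidableEq E] (hfr : CyclicAmpleFraming tl hd col) {C C' : Finset E}
    (hC : IsCycleSet tl hd C) (hC' : IsCycleSet tl hd C') {e : E} (he : e ∈ C) (he' : e ∈ C') :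
    C = C' := by
  obtain ⟨w, hw, rfl⟩ := hC
  obtain ⟨w', hw', rfl⟩ := hC'
  rw [List.mem_toFinset] at he he'
  ext x
  rw [List.mem_toFinset, List.mem_toFinset]
  exact ⟨hw.subset_of_mem hfr hw' he he' x, hw'.subset_of_mem hfr hw he' he x⟩

/-- The indicator flow of a cycle is a circulation. -/
theorem IsCycleSet.netflowR_eq_zero [Fintype E] [DecidableEq V] [DecidableEq E] {C : Finset E}
    (hC : IsCycleSet tl hd C) (v : V) :
    netflowR tl hd (fun e => if e ∈ C then 1 else 0) v = 0 := by
  obtain ⟨w, hw, rfl⟩ := hC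
  have key (g : E → V) : ∑ e ∈ Finset.univ.filter (fun e => g e = v),
      (if e ∈ w.toFinset then (1 : ℝ) else 0) =
        ((w.map g).map fun u => if u = v then (1 : ℝ) else 0).sum := by
    rw [List.map_map, ← List.sum_toFinset _ hw.nodup, Finset.sum_filter]
    simp only [← Finset.sum_filter, Function.comp_apply]
    rw [Finset.filter_filter, Finset.sum_filter, Finset.sum_filter,
      ← Finset.sum_subset (Finset.subset_univ w.toFinset)]
    · exact Finset.sum_congr rfl fun e he => by simp [List.mem_toFinset.1 he]
    · exact fun e _ he => if_neg fun h => he h.2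
  rw [netflowR, key, key, (hw.map_tl_perm.map _).sum_eq, sub_self]

/-- Every cycle has an edge lying on no route of a given family of pairwise compatible good
routes. -/
theorem IsMinCycle.exists_forall_not_mem [Fintype E] (hfr : CyclicAmpleFraming tl hd col)
    (hw : IsMinCycle tl hd w) {K : Set (List E)} (hgood : ∀ ρ ∈ K, IsGoodRoute tl hd ρ)
    (hK : ∀ ρ ∈ K, ∀ σ ∈ K, ¬ Incompat tl hd col ρ σ) : ∃ e ∈ w, ∀ ρ ∈ K, e ∉ ρ := by
  by_contra! hcov
  obtain ⟨c, hc⟩ := hfr.2 w hw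
  have long (n : ℕ) : ∃ T : List E, T.length = n + 1 ∧ (∀ x ∈ T, x ∈ w) ∧ ∃ ρ ∈ K, T <:+: ρ := by
    induction n with
    | zero =>
      obtain ⟨e, t, rfl⟩ := List.exists_cons_of_ne_nil hw.1.1
      obtain ⟨ρ, hρ, heρ⟩ := hcov e (by simp)
      exact ⟨[e], rfl, by simp, ρ, hρ, (List.singleton_infix_iff _ _).2 heρ⟩
    | succ n ih =>
      obtain ⟨T, hlen, hTw, ρ, hρ, hTρ⟩ := ih
      have hne : T ≠ [] := List.ne_nil_of_length_eq_add_one hlen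
      obtain ⟨q', hq', hq'T⟩ := hw.exists_tl_eq (hTw _ (List.getLast_mem hne))
      obtain ⟨ρ', hρ', hq'ρ⟩ := hcov q' hq'
      have hv := isInternal_of_hd_eq_tl hq'T.symm
      obtain ⟨q, hq⟩ := (hgood ρ hρ).1.exists_concat_infix hne hTρ hv.2
      have hqT := Composable.hd_getLast ((hgood ρ hρ).composable.infix hq) hne
      have hnew : ∀ x ∈ T ++ [q'], x ∈ w := by
        simpa [or_imp, forall_and] using ⟨hTw, hq'⟩
      rcases eq_or_ne q q' with rfl | hqq
      · exact ⟨T ++ [q], by simp [hlen], hnew, ρ, hρ, hq⟩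
      refine ⟨T ++ [q'], by simp [hlen], hnew, ρ', hρ', ?_⟩
      have hqc : col q ≠ c := fun h =>
        hqq (hfr.eq_of_tl_eq hv hqT.symm hq'T (h.trans (hc q' hq').symm))
      have hcomp := composable_concat hne ((hgood ρ hρ).composable.infix hTρ) hq'T.symm
      have key (S : List E) (hS : S <:+ T) : S ++ [q'] <:+: ρ' := by
        induction S with
        | nil => exact (List.singleton_infix_iff _ _).2 hq'ρ
        | cons t S ih =>
          replace ih := ih ((List.suffix_cons t S).trans hS)
          obtain ⟨U, rfl⟩ := hS
          have ht : col t = c := hc t (hTw t (by simp))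
          have hq'c : col q' = c := hc q' hq'
          have h1 : Composable tl hd (t :: (S ++ [q'])) := hcomp.infix ⟨U, [], by simp⟩
          have h2 : t :: (S ++ [q]) <:+: ρ := List.IsInfix.trans ⟨U, [], by simp⟩ hq
          obtain ⟨y, Y, hY⟩ : ∃ y Y, S ++ [q'] = y :: Y :=
            List.exists_cons_of_ne_nil (by simp)
          have hty : hd t = tl y := by
            rw [hY] at h1
            exact (List.isChain_cons_cons.1 h1).1
          have htv := isInternal_of_hd_eq_tl hty
          obtain ⟨z, hz⟩ : ∃ z, z :: (S ++ [q']) <:+: ρ' := by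
            rw [hY] at ih ⊢
            exact (hgood ρ' hρ').1.exists_cons_infix ih (hty ▸ htv.1)
          have hzy : hd z = tl y := by
            have := (hgood ρ' hρ').composable.infix hz
            rw [hY] at this
            exact (List.isChain_cons_cons.1 this).1
          rcases eq_or_ne z t with rfl | hzt
          · exact hz
          have hzc : col z ≠ c := fun h =>
            hzt (hfr.eq_of_hd_eq htv (hzy.trans hty.symm) rfl (h.trans ht.symm))
          have hρs := (hgood ρ hρ).1
          have hρs' := (hgood ρ' hρ').1
          have hh := hty.trans hzy.symm
          cases c with
          | blue =>
            refine absurd (incompat_of_infix hρs hρs' h2 hz hh ht hq'c ?_ ?_) (hK ρ hρ ρ' hρ')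
            · cases h : col q <;> simp_all
            · cases h : col z <;> simp_all
          | red =>
            refine absurd (incompat_of_infix hρs' hρs hz h2 hh.symm ?_ ?_ hq'c ht)
              (hK ρ' hρ' ρ hρ)
            · cases h : col z <;> simp_all
            · cases h : col q <;> simp_all
      exact key T (List.suffix_refl T)
  obtain ⟨T, hlen, -, ρ, hρ, hTρ⟩ := long (Fintype.card E)
  have h1 := hTρ.sublist.length_le
  have h2 := (hgood ρ hρ).nodup.length_le_card
  omega

end Cycles

section Residual

variable [DecidableEq E] {tl hd : E → V} {col : E → Col} {f : E → ℝ}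

/-- The largest multiple of a cycle which can be subtracted from a flow. -/
noncomputable def cycleFlow (f : E → ℝ) (C : {C : Finset E // IsCycleSet tl hd C}) : ℝ :=
  C.1.inf' C.2.nonempty f

theorem cycleFlow_nonneg (hf : ∀ e, 0 ≤ f e) (C : {C : Finset E // IsCycleSet tl hd C}) :
    0 ≤ cycleFlow f C :=
  Finset.le_inf' _ _ fun e _ => hf e

theorem cycleFlow_le {C : {C : Finset E // IsCycleSet tl hd C}} {e : E} (he : e ∈ C.1) :
    cycleFlow f C ≤ f e :=
  Finset.inf'_le _ he

theorem exists_cycleFlow_eq (f : E → ℝ) (C : {C : Finset E // IsCycleSet tl hd C}) :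
    ∃ e ∈ C.1, cycleFlow f C = f e :=
  Finset.exists_mem_eq_inf' _ _

variable [Fintype {C : Finset E // IsCycleSet tl hd C}]

theorem sum_cycles_of_mem (hfr : CyclicAmpleFraming tl hd col)
    (m : {C : Finset E // IsCycleSet tl hd C} → ℝ) {C : {C : Finset E // IsCycleSet tl hd C}}
    {e : E} (he : e ∈ C.1) : ∑ C, m C * (if e ∈ C.1 then 1 else 0) = m C := by
  rw [Finset.sum_eq_single C, if_pos he, mul_one]
  · intro C' _ hC'
    rw [if_neg, mul_zero]
    exact fun he' => hC' (Subtype.ext (C'.2.eq_of_mem hfr C.2 he' he))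
  · exact fun h => absurd (Finset.mem_univ C) h

variable (tl hd) in
/-- What remains of a flow after subtracting as much as possible along every cycle. -/
noncomputable def residual (f : E → ℝ) (e : E) : ℝ :=
  f e - ∑ C : {C : Finset E // IsCycleSet tl hd C}, cycleFlow f C * (if e ∈ C.1 then 1 else 0)

theorem residual_nonneg (hfr : CyclicAmpleFraming tl hd col) (hf : ∀ e, 0 ≤ f e) (e : E) :
    0 ≤ residual tl hd f e := by
  by_cases h : ∃ C : {C : Finset E // IsCycleSet tl hd C}, e ∈ C.1
  · obtain ⟨C, hC⟩ := h
    rw [residual, sum_cycles_of_mem hfr _ hC]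
    exact sub_nonneg.2 (cycleFlow_le hC)
  · push Not at h
    rw [residual, Finset.sum_eq_zero fun C _ => by rw [if_neg (h C), mul_zero], sub_zero]
    exact hf e

theorem exists_residual_eq_zero (hfr : CyclicAmpleFraming tl hd col) {w : List E}
    (hw : IsMinCycle tl hd w) : ∃ e ∈ w, residual tl hd f e = 0 := by
  obtain ⟨e, he, hfe⟩ := exists_cycleFlow_eq (tl := tl) (hd := hd) f ⟨w.toFinset, w, hw, rfl⟩
  refine ⟨e, List.mem_toFinset.1 he, ?_⟩
  rw [residual, sum_cycles_of_mem hfr _ he, hfe, sub_self]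

theorem netflowR_residual [Fintype E] [DecidableEq V] (v : V) :
    netflowR tl hd (residual tl hd f) v = netflowR tl hd f v := by
  have key (C : {C : Finset E // IsCycleSet tl hd C}) := C.2.netflowR_eq_zero v
  simp only [netflowR, sub_eq_zero] at key
  simp only [netflowR, residual, Finset.sum_sub_distrib]
  rw [Finset.sum_comm, Finset.sum_comm (s := Finset.univ.filter fun e => hd e = v)]
  simp only [← Finset.mul_sum, key]
  ring

end Residual

section Integrality

variable [Fintype E] [DecidableEq V] {tl hd : E → V} {col : E → Col} {f : E → ℝ}
  {A : AddSubgroup ℝ}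

theorem strip_mem (h : ∀ e, f e ∈ A) {y : ℝ} (hy : y ∈ A) (e : E) :
    strip tl hd col f y e ∈ A := by
  have h1 : inShift hd col f e ∈ A := by
    unfold inShift
    split_ifs
    exacts [A.sum_mem fun x _ => h x, A.zero_mem]
  have h2 : outShift tl col f e ∈ A := by
    unfold outShift
    split_ifs
    exacts [A.sum_mem fun x _ => h x, A.zero_mem]
  have h3 : min (f e) (y - outShift tl col f e) ∈ A := by
    rcases min_choice (f e) (y - outShift tl col f e) with h3 | h3 <;> rw [h3]
    exacts [h e, A.sub_mem hy h2]
  refine A.add_mem ?_ h1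
  rcases max_choice 0 (min (f e) (y - outShift tl col f e)) with h4 | h4 <;> rw [h4]
  exacts [A.zero_mem, h3]

theorem transport_mem (h : ∀ e, f e ∈ A) {y : ℝ} (hy : y ∈ A) (w : List E) :
    transport tl hd col f w y ∈ A := by
  induction w generalizing y with
  | nil => exact hy
  | cons e w ih => exact ih (strip_mem h hy e)

theorem width_mem (h : ∀ e, f e ∈ A) (w : List E) : width tl hd col f w ∈ A :=
  A.sub_mem (transport_mem h (A.sum_mem fun e _ => h e) w) (transport_mem h A.zero_mem w)

omit [Fintype E] [DecidableEq V] in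
theorem cycleFlow_mem [DecidableEq E] (h : ∀ e, f e ∈ A)
    (C : {C : Finset E // IsCycleSet tl hd C}) : cycleFlow f C ∈ A := by
  obtain ⟨e, -, he⟩ := exists_cycleFlow_eq f C
  exact he ▸ h e

omit [Fintype E] [DecidableEq V] in
theorem residual_mem [DecidableEq E] [Fintype {C : Finset E // IsCycleSet tl hd C}]
    (h : ∀ e, f e ∈ A) (e : E) : residual tl hd f e ∈ A := by
  refine A.sub_mem (h e) (A.sum_mem fun C _ => ?_)
  split_ifs
  · rw [mul_one]
    exact cycleFlow_mem h C
  · rw [mul_zero]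
    exact A.zero_mem

end Integrality

section Decomposition

variable [Fintype E] [DecidableEq E] {tl hd : E → V} {col : E → Col} {f : E → ℝ}

instance finite_isGoodRoute : Finite {w : List E // IsGoodRoute tl hd w} :=
  Finite.of_injective (β := {l : List E // l.Nodup}) (fun w => ⟨w.1, w.2.nodup⟩) fun _ _ h =>
    Subtype.ext (Subtype.mk.inj h)

variable [Fintype {C : Finset E // IsCycleSet tl hd C}]
  [Fintype {w : List E // IsGoodRoute tl hd w}]

omit [Fintype E] in
theorem finsum_mul_rInd (a : RoutesT tl hd → ℝ) (e : E) :
    ∑ᶠ r : RoutesT tl hd, a r * rInd tl hd r e =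
      ∑ C, a (.inl C) * (if e ∈ C.1 then 1 else 0) +
        weight (fun ρ => a (.inr ρ)) (fun ρ => e ∈ ρ.1) := by
  rw [finsum_eq_sum_of_fintype, Fintype.sum_sum_type, weight]
  congr 1
  refine Finset.sum_congr rfl fun ρ _ => ?_
  change a _ * (ρ.1.count e : ℝ) = _
  split_ifs with h
  · rw [List.count_eq_one_of_mem ρ.2.nodup h, Nat.cast_one, mul_one]
  · rw [List.count_eq_zero_of_not_mem h, Nat.cast_zero, mul_zero]

variable [DecidableEq V]

variable (tl hd col f) in
/-- The coefficients of the decomposition of a flow into pairwise compatible routes. -/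
noncomputable def routeCoeff : RoutesT tl hd → ℝ
  | .inl C => cycleFlow f C
  | .inr ρ => width tl hd col (residual tl hd f) ρ.1

omit [Fintype {w : List E // IsGoodRoute tl hd w}] in
theorem routeCoeff_nonneg (hfr : CyclicAmpleFraming tl hd col) (hf : ∀ e, 0 ≤ f e) :
    ∀ r, 0 ≤ routeCoeff tl hd col f r
  | .inl C => cycleFlow_nonneg hf C
  | .inr _ => width_nonneg (residual_nonneg hfr hf) _

omit [Fintype {w : List E // IsGoodRoute tl hd w}] in
theorem rClique_support_routeCoeff (hfr : CyclicAmpleFraming tl hd col) (hf : ∀ e, 0 ≤ f e) :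
    RClique tl hd col (Function.support (routeCoeff tl hd col f)) := by
  rintro (C | ρ) hr (C' | ρ') hr' <;> try trivial
  exact not_incompat_of_width_pos hfr (residual_nonneg hfr hf)
    ((routeCoeff_nonneg hfr hf (.inr ρ)).lt_of_ne' hr)
    ((routeCoeff_nonneg hfr hf (.inr ρ')).lt_of_ne' hr')

theorem eq_finsum_routeCoeff (hfr : CyclicAmpleFraming tl hd col) (hf : ∀ e, 0 ≤ f e)
    (hbal : ∀ v : V, IsInternal tl hd v → netflowR tl hd f v = 0) (e : E) :
    f e = ∑ᶠ r : RoutesT tl hd, routeCoeff tl hd col f r * rInd tl hd r e := by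
  have h := eq_sum_width hfr (residual_nonneg hfr hf)
    (fun v hv => (netflowR_residual v).trans (hbal v hv))
    (fun w hw => exists_residual_eq_zero hfr hw) e
  rw [finsum_mul_rInd]
  refine eq_add_of_sub_eq' (h.trans (Finset.sum_congr rfl fun ρ _ => ?_))
  split_ifs <;> rfl

theorem eq_routeCoeff (hfr : CyclicAmpleFraming tl hd col)
    (hbal : ∀ v : V, IsInternal tl hd v → netflowR tl hd f v = 0)
    {a : RoutesT tl hd → ℝ} (ha : ∀ r, 0 ≤ a r)
    (hK : RClique tl hd col (Function.support a))
    (hsum : ∀ e, f e = ∑ᶠ r : RoutesT tl hd, a r * rInd tl hd r e) :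
    a = routeCoeff tl hd col f := by
  simp only [finsum_mul_rInd] at hsum
  have hcycle (C) : a (.inl C) = cycleFlow f C := by
    have hle (e : E) (he : e ∈ C.1) : a (.inl C) ≤ f e := by
      rw [hsum, sum_cycles_of_mem hfr (fun C => a (.inl C)) he]
      exact le_add_of_nonneg_right (weight_nonneg fun ρ => ha _)
    obtain ⟨w, hw, hwC⟩ := C.2
    obtain ⟨e, he, h⟩ := hw.exists_forall_not_mem hfr
      (K := {ρ | ∃ h : IsGoodRoute tl hd ρ, a (.inr ⟨ρ, h⟩) ≠ 0}) (fun ρ h => h.1) (by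
        rintro ρ ⟨h, hρ⟩ σ ⟨h', hσ⟩
        exact hK _ hρ _ hσ)
    have heC : e ∈ C.1 := by rw [← hwC]; exact List.mem_toFinset.2 he
    refine le_antisymm (Finset.le_inf' _ _ hle) ((cycleFlow_le heC).trans_eq ?_)
    rw [hsum, sum_cycles_of_mem hfr (fun C => a (.inl C)) heC,
      (weight_congr_support fun ρ hρ => iff_false_intro (h ρ.1 ⟨ρ.2, hρ⟩)).trans weight_false,
      add_zero]
  funext r
  rcases r with C | ρ
  · exact hcycle C
  · refine eq_width (a := fun ρ => a (.inr ρ)) hfr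
      (fun v hv => (netflowR_residual v).trans (hbal v hv))
      (fun w hw => exists_residual_eq_zero hfr hw) (fun ρ => ha _)
      (fun ρ σ hρ hσ => hK _ hρ _ hσ) (fun e => ?_) ρ
    simp only [residual, ← hcycle, hsum e]
    ring

omit [Fintype {w : List E // IsGoodRoute tl hd w}] in
theorem routeCoeff_mem {A : AddSubgroup ℝ} (h : ∀ e, f e ∈ A) :
    ∀ r, routeCoeff tl hd col f r ∈ A
  | .inl C => cycleFlow_mem h C
  | .inr _ => width_mem (residual_mem h) _

end Decomposition

/-- every balanced nonnegative flow can be written uniquely as a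
nonnegative combination of indicator flows of pairwise compatible routes;
moreover if the flow is integer-valued then so are the coefficients. -/
theorem statement6 {V E : Type*} [Fintype V] [Fintype E] [DecidableEq V] [DecidableEq E]
    (tl hd : E → V) (col : E → Col)
    (hconn : Connected tl hd) (hdeg : DegreeOneEnds tl hd) (hidle : NoIdleEdges tl hd)
    (hfr : CyclicAmpleFraming tl hd col)
    (f : E → ℝ) (hf0 : ∀ e : E, 0 ≤ f e)
    (hbal : ∀ v : V, IsInternal tl hd v → netflowR tl hd f v = 0) :
    (∃! a : RoutesT tl hd → ℝ,
      (∀ r, 0 ≤ a r) ∧ (Function.support a).Finite ∧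
      RClique tl hd col (Function.support a) ∧
      ∀ e : E, f e = ∑ᶠ r : RoutesT tl hd, a r * rInd tl hd r e) ∧
    (∀ a : RoutesT tl hd → ℝ,
      ((∀ r, 0 ≤ a r) ∧ (Function.support a).Finite ∧
        RClique tl hd col (Function.support a) ∧
        ∀ e : E, f e = ∑ᶠ r : RoutesT tl hd, a r * rInd tl hd r e) →
      (∀ e : E, ∃ n : ℤ, f e = n) → ∀ r, ∃ n : ℤ, a r = n) := by
  have := Fintype.ofFinite {C : Finset E // IsCycleSet tl hd C}
  have := Fintype.ofFinite {w : List E // IsGoodRoute tl hd w}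
  refine ⟨⟨routeCoeff tl hd col f, ⟨routeCoeff_nonneg hfr hf0, Set.toFinite _,
    rClique_support_routeCoeff hfr hf0, eq_finsum_routeCoeff hfr hf0 hbal⟩, ?_⟩, ?_⟩
  · rintro a ⟨ha, -, hK, hsum⟩
    exact eq_routeCoeff hfr hbal ha hK hsum
  · rintro a ⟨ha, -, hK, hsum⟩ hfint r
    rw [eq_routeCoeff hfr hbal ha hK hsum]
    obtain ⟨n, hn⟩ := routeCoeff_mem (A := (Int.castAddHom ℝ).range)
      (fun e => (hfint e).imp fun _ h => h.symm) r
    exact ⟨n, hn.symm⟩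

end PaperDKK
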